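/- (Quantale law for the propagation tensor.) Let L be a complete lattice, let ê^*, ê_* : DI(L) → DI(L) form a Galois adjunction, and define A ⊗ₑ B = ê^*(A ∩ B) for A, B ∈ DI(L). Then ⊗ₑ is commutative and distributes over arbitrary joins of DI(L): for every A ∈ DI(L) and every family ℬ ⊆ DI(L), A ⊗ₑ 𝒞(⋃ℬ) = 𝒞(⋃ {A ⊗ₑ B | B ∈ ℬ}). -/

import Mathlib

def IsDistribSet {L : Type*} [CompleteLattice L] (S : Set L) : Prop :=
  ∀ b : L, b ⊓ sSup S = sSup ((fun s => b ⊓ s) '' S)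

def IsDistribIdeal {L : Type*} [CompleteLattice L] (I : Set L) : Prop :=
  I.Nonempty ∧ IsLowerSet I ∧ ∀ S ⊆ I, IsDistribSet S → sSup S ∈ I

def DIcl {L : Type*} [CompleteLattice L] (A : Set L) : Set L :=
  ⋂₀ {I : Set L | IsDistribIdeal I ∧ A ⊆ I}


theorem di_bot {L : Type*} [CompleteLattice L] {I : Set L} (h : IsDistribIdeal I) : ⊥ ∈ I := by
  obtain ⟨⟨x, hx⟩, hl, _⟩ := h
  exact hl bot_le hx

theorem di_sInter {L : Type*} [CompleteLattice L] {F : Set (Set L)}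
    (h : ∀ I ∈ F, IsDistribIdeal I) : IsDistribIdeal (⋂₀ F) := by
  refine ⟨⟨⊥, fun I hI => di_bot (h I hI)⟩, ?_, ?_⟩
  · intro a b hab ha I hI
    exact (h I hI).2.1 hab (ha I hI)
  · intro S hS hd I hI
    exact (h I hI).2.2 S (fun s hs => hS hs I hI) hd

theorem di_inter {L : Type*} [CompleteLattice L] {I J : Set L}
    (hI : IsDistribIdeal I) (hJ : IsDistribIdeal J) : IsDistribIdeal (I ∩ J) := by
  rw [← Set.sInter_pair]
  apply di_sInter
  rintro K (rfl | rfl)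
  · exact hI
  · exact hJ

theorem di_cl {L : Type*} [CompleteLattice L] (A : Set L) : IsDistribIdeal (DIcl A) :=
  di_sInter fun _ hI => hI.1

theorem di_imp {L : Type*} [CompleteLattice L] (A : Set L) {J : Set L}
    (hJ : IsDistribIdeal J) : IsDistribIdeal {x : L | ∀ a ∈ A, a ⊓ x ∈ J} := by
  refine ⟨⟨⊥, fun a _ => ?_⟩, ?_, ?_⟩
  · rw [inf_bot_eq]
    exact di_bot hJ
  · intro x y hyx hx a ha
    exact hJ.2.1 (inf_le_inf_left a hyx) (hx a ha)
  · intro S hS hd a ha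
    rw [hd a]
    apply hJ.2.2
    · rintro _ ⟨s, hs, rfl⟩
      exact hS hs a ha
    · intro b
      rw [← hd a, ← inf_assoc, hd (b ⊓ a), Set.image_image]
      simp only [inf_assoc]

/-- Quantale law for the propagation tensor `A ⊗ₑ B := ê^*(A ∩ B)`:
it is commutative and distributes over arbitrary joins of `DI(L)`
(joins being `𝒞` of unions). -/
theorem propagation_tensor_quantale {L : Type*} [CompleteLattice L]
    (es ec : Set L → Set L)
    (hes : ∀ X : Set L, IsDistribIdeal X → IsDistribIdeal (es X))
    (hec : ∀ Y : Set L, IsDistribIdeal Y → IsDistribIdeal (ec Y))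
    (hadj : ∀ X Y : Set L, IsDistribIdeal X → IsDistribIdeal Y →
      (es X ⊆ Y ↔ X ⊆ ec Y))
    (A : Set L) (hA : IsDistribIdeal A)
    (ℬ : Set (Set L)) (hℬ : ∀ B ∈ ℬ, IsDistribIdeal B) :
    (∀ X Y : Set L, IsDistribIdeal X → IsDistribIdeal Y → es (X ∩ Y) = es (Y ∩ X)) ∧
    es (A ∩ DIcl (⋃₀ ℬ)) = DIcl (⋃ B ∈ ℬ, es (A ∩ B)) := by
  refine ⟨fun X Y _ _ => by rw [Set.inter_comm], ?_⟩
  have hAC := di_inter hA (di_cl (⋃₀ ℬ))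
  apply Set.Subset.antisymm
  · apply Set.subset_sInter
    rintro Y ⟨hY, hsub⟩
    rw [hadj _ _ hAC hY]
    rintro x ⟨hxA, hx⟩
    have hk := hx {x : L | ∀ a ∈ A, a ⊓ x ∈ ec Y} ⟨di_imp A (hec Y hY), by
      rintro y ⟨B, hB, hy⟩ a ha
      have h1 : es (A ∩ B) ⊆ Y := fun z hz => hsub (Set.mem_biUnion hB hz)
      exact (hadj _ _ (di_inter hA (hℬ B hB)) hY).1 h1
        ⟨hA.2.1 inf_le_left ha, (hℬ B hB).2.1 inf_le_right hy⟩⟩ x hxA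
    rwa [inf_idem] at hk
  · apply Set.sInter_subset_of_mem
    refine ⟨hes _ hAC, Set.iUnion₂_subset fun B hB => ?_⟩
    rw [hadj _ _ (di_inter hA (hℬ B hB)) (hes _ hAC)]
    refine Set.Subset.trans ?_ ((hadj _ _ hAC (hes _ hAC)).1 (Set.Subset.refl _))
    rintro x ⟨hxA, hxB⟩
    exact ⟨hxA, fun I hI => hI.2 ⟨B, hB, hxB⟩⟩
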